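/- For every m > 0, Ω > 0, σ > 0, and every r ≥ 0, the series ∑_{k=1}^∞ 2 e^{−σ² k²/2} I_{k,m}(r) converges; consequently, for every real φ the series S(r, φ) = I_{0,m}(r) + ∑_{k=1}^∞ 2(−1)^k e^{−σ² k²/2} cos(k φ) I_{k,m}(r) converges absolutely. -/

import Mathlib

open Real

/-- The Pochhammer symbol `(x)_n = x (x+1) ⋯ (x+n−1)` over the reals. -/
noncomputable def poch (x : ℝ) (n : ℕ) : ℝ := (ascPochhammer ℝ n).eval x

/-- The confluent hypergeometric function of the first kind
`₁F₁(a; b; z) = ∑ₙ ((a)ₙ / (b)ₙ) zⁿ / n!`. -/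
noncomputable def oneF1 (a b z : ℝ) : ℝ :=
  ∑' n : ℕ, poch a n / poch b n * z ^ n / (n.factorial : ℝ)

/-- `I_{k,m}(r) = (Γ(m + k/2) / (2 β^{m+k/2} k!)) r^k ₁F₁(m + k/2; k+1; r²/β)`,
where `β = 1 + m/Ω`. -/
noncomputable def Ikm (m Ω : ℝ) (k : ℕ) (r : ℝ) : ℝ :=
  Real.Gamma (m + (k : ℝ) / 2) /
      (2 * (1 + m / Ω) ^ (m + (k : ℝ) / 2) * (k.factorial : ℝ)) * r ^ k *
    oneF1 (m + (k : ℝ) / 2) ((k : ℝ) + 1) (r ^ 2 / (1 + m / Ω))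

theorem poch_succ (x : ℝ) (n : ℕ) : poch x (n + 1) = poch x n * (x + n) :=
  ascPochhammer_succ_eval n x

theorem poch_pos {x : ℝ} (hx : 0 < x) (n : ℕ) : 0 < poch x n :=
  ascPochhammer_pos n x hx

theorem poch_div_poch_le {a b c : ℝ} (ha : 0 < a) (hb : 0 < b) (hc : 1 ≤ c) (hab : a ≤ c * b)
    (n : ℕ) : poch a n / poch b n ≤ c ^ n := by
  rw [div_le_iff₀ (poch_pos hb n)]
  induction n with
  | zero => simp [poch]
  | succ n ih =>
    have hn : (n : ℝ) ≤ c * n := le_mul_of_one_le_left n.cast_nonneg hc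
    have hbn := (poch_pos hb n).le
    rw [poch_succ, poch_succ]
    calc poch a n * (a + n) ≤ (c ^ n * poch b n) * (c * (b + n)) := by
          gcongr
          linarith
      _ = c ^ (n + 1) * (poch b n * (b + n)) := by ring

theorem oneF1_nonneg {a b z : ℝ} (ha : 0 < a) (hb : 0 < b) (hz : 0 ≤ z) : 0 ≤ oneF1 a b z :=
  tsum_nonneg fun n => by
    have := poch_pos ha n
    have := poch_pos hb n
    positivity

theorem oneF1_le_exp {a b c z : ℝ} (ha : 0 < a) (hb : 0 < b) (hc : 1 ≤ c) (hab : a ≤ c * b)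
    (hz : 0 ≤ z) : oneF1 a b z ≤ Real.exp (c * z) := by
  have hle (n : ℕ) :
      poch a n / poch b n * z ^ n / (n.factorial : ℝ) ≤ (c * z) ^ n / (n.factorial : ℝ) := by
    rw [mul_pow]
    gcongr
    exact poch_div_poch_le ha hb hc hab n
  have hsum := Real.summable_pow_div_factorial (c * z)
  have hnonneg (n : ℕ) : 0 ≤ poch a n / poch b n * z ^ n / (n.factorial : ℝ) := by
    have := poch_pos ha n
    have := poch_pos hb n
    positivity
  rw [Real.exp_eq_exp_ℝ, NormedSpace.exp_eq_tsum_div]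
  exact (Summable.of_nonneg_of_le hnonneg hle hsum).tsum_le_tsum hle hsum

theorem Gamma_add_half_le {x : ℝ} (hx : 0 < x) :
    Real.Gamma (x + 1 / 2) ≤ √x * Real.Gamma x := by
  have h := Real.Gamma_mul_add_mul_le_rpow_Gamma_mul_rpow_Gamma (s := x) (t := x + 1)
    (a := 1 / 2) (b := 1 / 2) hx (by linarith) (by norm_num) (by norm_num) (by norm_num)
  rw [← Real.sqrt_eq_rpow, ← Real.sqrt_eq_rpow, Real.Gamma_add_one hx.ne',
    Real.sqrt_mul hx.le] at h
  calc Real.Gamma (x + 1 / 2) = Real.Gamma (1 / 2 * x + 1 / 2 * (x + 1)) := by ring_nf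
    _ ≤ √(Real.Gamma x) * (√x * √(Real.Gamma x)) := h
    _ = √x * (√(Real.Gamma x) * √(Real.Gamma x)) := by ring
    _ = √x * Real.Gamma x := by rw [Real.mul_self_sqrt (Real.Gamma_pos_of_pos hx).le]

theorem Gamma_add_half_nat_le {m : ℝ} (hm : 0 < m) (k : ℕ) :
    Real.Gamma (m + (k : ℝ) / 2) ≤ Real.Gamma m * (m + 1) ^ k * (k.factorial : ℝ) := by
  induction k with
  | zero => simp
  | succ k ih =>
    have hx : 0 < m + (k : ℝ) / 2 := by positivity
    have hsqrt : √(m + (k : ℝ) / 2) ≤ (m + 1) * ((k : ℝ) + 1) := by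
      rw [Real.sqrt_le_left (by positivity)]
      have hk : (0 : ℝ) ≤ k := k.cast_nonneg
      have hmk : 0 ≤ m * k := by positivity
      nlinarith
    have hG := (Real.Gamma_pos_of_pos hx).le
    calc Real.Gamma (m + ((k + 1 : ℕ) : ℝ) / 2)
        = Real.Gamma (m + (k : ℝ) / 2 + 1 / 2) := by push_cast; ring_nf
      _ ≤ √(m + (k : ℝ) / 2) * Real.Gamma (m + (k : ℝ) / 2) := Gamma_add_half_le hx
      _ ≤ ((m + 1) * ((k : ℝ) + 1)) * (Real.Gamma m * (m + 1) ^ k * (k.factorial : ℝ)) := by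
          gcongr
      _ = Real.Gamma m * (m + 1) ^ (k + 1) * ((k + 1).factorial : ℝ) := by
          rw [Nat.factorial_succ]
          push_cast
          ring

theorem Ikm_nonneg {m Ω r : ℝ} (hm : 0 < m) (hΩ : 0 < Ω) (hr : 0 ≤ r) (k : ℕ) :
    0 ≤ Ikm m Ω k r := by
  have hx : 0 < m + (k : ℝ) / 2 := by positivity
  have := Real.Gamma_pos_of_pos hx
  have : 0 ≤ oneF1 (m + (k : ℝ) / 2) ((k : ℝ) + 1) (r ^ 2 / (1 + m / Ω)) :=
    oneF1_nonneg hx (by positivity) (by positivity)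
  unfold Ikm
  positivity

theorem Ikm_le {m Ω r : ℝ} (hm : 0 < m) (hΩ : 0 < Ω) (hr : 0 ≤ r) (k : ℕ) :
    Ikm m Ω k r ≤
      Real.Gamma m * Real.exp ((m + 1) * (r ^ 2 / (1 + m / Ω))) * ((m + 1) * r) ^ k := by
  have hx : 0 < m + (k : ℝ) / 2 := by positivity
  have hG := Real.Gamma_pos_of_pos hm
  have hβ : (1 : ℝ) ≤ (1 + m / Ω) ^ (m + (k : ℝ) / 2) :=
    Real.one_le_rpow (by linarith [div_pos hm hΩ]) hx.le
  have hF : oneF1 (m + (k : ℝ) / 2) ((k : ℝ) + 1) (r ^ 2 / (1 + m / Ω)) ≤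
      Real.exp ((m + 1) * (r ^ 2 / (1 + m / Ω))) :=
    oneF1_le_exp hx (by positivity) (by linarith)
      (by nlinarith [mul_nonneg hm.le (k.cast_nonneg (α := ℝ)), k.cast_nonneg (α := ℝ)])
      (by positivity)
  have hcoeff : Real.Gamma (m + (k : ℝ) / 2) /
      (2 * (1 + m / Ω) ^ (m + (k : ℝ) / 2) * (k.factorial : ℝ)) ≤
      Real.Gamma m * (m + 1) ^ k := by
    rw [div_le_iff₀ (by positivity)]
    calc Real.Gamma (m + (k : ℝ) / 2)
        ≤ Real.Gamma m * (m + 1) ^ k * (1 * (k.factorial : ℝ)) := by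
          rw [one_mul]
          exact Gamma_add_half_nat_le hm k
      _ ≤ _ := by
          gcongr
          linarith
  calc Ikm m Ω k r
      ≤ Real.Gamma m * (m + 1) ^ k * r ^ k *
          Real.exp ((m + 1) * (r ^ 2 / (1 + m / Ω))) := by
        unfold Ikm
        gcongr
        exact oneF1_nonneg hx (by positivity) (by positivity)
    _ = _ := by rw [mul_pow]; ring

theorem summable_exp_neg_sq_mul_pow {σ : ℝ} (hσ : 0 < σ) {A : ℝ} (hA : 0 < A) :
    Summable fun k : ℕ => Real.exp (-(σ ^ 2 * (k : ℝ) ^ 2) / 2) * A ^ k := by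
  refine summable_of_ratio_test_tendsto_lt_one (l := 0) one_pos
    (Filter.Eventually.of_forall fun k => by positivity) ?_
  have hratio (k : ℕ) :
      ‖Real.exp (-(σ ^ 2 * ((k + 1 : ℕ) : ℝ) ^ 2) / 2) * A ^ (k + 1)‖ /
        ‖Real.exp (-(σ ^ 2 * (k : ℝ) ^ 2) / 2) * A ^ k‖ =
      A * Real.exp (-(σ ^ 2 / 2)) * Real.exp (-σ ^ 2) ^ k := by
    rw [Real.norm_of_nonneg (by positivity), Real.norm_of_nonneg (by positivity),
      div_eq_iff (by positivity), ← Real.exp_nat_mul]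
    have hexp : Real.exp (-(σ ^ 2 * ((k + 1 : ℕ) : ℝ) ^ 2) / 2) =
        Real.exp (-(σ ^ 2 / 2)) * Real.exp (k * -σ ^ 2) *
          Real.exp (-(σ ^ 2 * (k : ℝ) ^ 2) / 2) := by
      rw [← Real.exp_add, ← Real.exp_add]
      push_cast
      ring_nf
    rw [hexp]
    ring
  simp_rw [hratio]
  have hlt : Real.exp (-σ ^ 2) < 1 := by
    rw [← Real.exp_zero, Real.exp_lt_exp]
    nlinarith
  simpa using (tendsto_pow_atTop_nhds_zero_of_lt_one (Real.exp_pos _).le hlt).const_mul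
    (A * Real.exp (-(σ ^ 2 / 2)))

/-- For every `m > 0`, `Ω > 0`, `σ > 0`, and `r ≥ 0`, the series
`∑_{k=1}^∞ 2 e^{−σ² k²/2} I_{k,m}(r)` converges; consequently, for every real `φ`
the series `S(r, φ) = I_{0,m}(r) + ∑_{k=1}^∞ 2(−1)^k e^{−σ² k²/2} cos(k φ) I_{k,m}(r)`
converges absolutely. -/
theorem mlg_series_summable (m Ω σ r : ℝ) (hm : 0 < m) (hΩ : 0 < Ω) (hσ : 0 < σ)
    (hr : 0 ≤ r) :
    (Summable fun k : ℕ =>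
        2 * Real.exp (-(σ ^ 2 * ((k : ℝ) + 1) ^ 2) / 2) * Ikm m Ω (k + 1) r) ∧
    ∀ φ : ℝ, Summable fun k : ℕ =>
        |2 * (-1 : ℝ) ^ (k + 1) * Real.exp (-(σ ^ 2 * ((k : ℝ) + 1) ^ 2) / 2) *
          Real.cos (((k : ℝ) + 1) * φ) * Ikm m Ω (k + 1) r| := by
  have hsum : Summable fun k : ℕ =>
      2 * Real.exp (-(σ ^ 2 * ((k : ℝ) + 1) ^ 2) / 2) * Ikm m Ω (k + 1) r := by
    have hG := Real.Gamma_pos_of_pos hm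
    have hbound := (((summable_nat_add_iff 1).2 (summable_exp_neg_sq_mul_pow hσ
      (A := (m + 1) * r + 1) (by positivity))).mul_left
        (2 * (Real.Gamma m * Real.exp ((m + 1) * (r ^ 2 / (1 + m / Ω))))))
    refine Summable.of_nonneg_of_le (fun k => ?_) (fun k => ?_) hbound
    · have := Ikm_nonneg hm hΩ hr (k + 1)
      positivity
    · calc 2 * Real.exp (-(σ ^ 2 * ((k : ℝ) + 1) ^ 2) / 2) * Ikm m Ω (k + 1) r
          ≤ 2 * Real.exp (-(σ ^ 2 * ((k : ℝ) + 1) ^ 2) / 2) *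
            (Real.Gamma m * Real.exp ((m + 1) * (r ^ 2 / (1 + m / Ω))) *
              ((m + 1) * r + 1) ^ (k + 1)) := by
            gcongr
            refine (Ikm_le hm hΩ hr (k + 1)).trans ?_
            gcongr
            linarith
        _ = _ := by
            push_cast
            ring
  refine ⟨hsum, fun φ => Summable.of_nonneg_of_le (fun k => abs_nonneg _) (fun k => ?_) hsum⟩
  have hI := Ikm_nonneg hm hΩ hr (k + 1)
  simp only [abs_mul, abs_pow, abs_neg, abs_one, one_pow, mul_one, Nat.abs_ofNat, Real.abs_exp,
    abs_of_nonneg hI]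
  exact mul_le_mul_of_nonneg_right
    (mul_le_of_le_one_right (by positivity) (Real.abs_cos_le_one _)) hI
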